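/- arXiv:0904.3979 — 2 statements merged into one kernel-verified Lean document; each statement's English description precedes it below -/
import Mathlib

section
/- Let k ≥ 4 be an integer. Let σ_{2,k} be the cyclic permutation of P_k with σ_{2,k}(i) = i+1 for 1 ≤ i ≤ k−1 and σ_{2,k}(k) = 1, and let σ_{k,k} be the cyclic permutation of P_k with σ_{k,k}(1) = k and σ_{k,k}(j) = j−1 for 2 ≤ j ≤ k. Then σ_{2,k} and σ_{k,k} are two-sided similar, but neither right similar nor left similar; moreover the Petrie matrices M_{σ_{2,k}} and M_{σ_{k,k}} are similar over ℝ. -/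
open Matrix

/-- `σ` is a permutation of `P_n = {1,…,n}`, viewed as a function `ℕ → ℕ`. -/
def IsPermOn (n : ℕ) (σ : ℕ → ℕ) : Prop :=
  Set.BijOn σ (Set.Icc 1 n) (Set.Icc 1 n)

/-- The Petrie matrix of a map `σ` on `P_n`: the `(n-1) × (n-1)` real matrix whose
`(i,j)` entry (with `1`-based indices) is `1` iff
`min (σ i) (σ (i+1)) ≤ j ≤ max (σ i) (σ (i+1)) - 1`, and `0` otherwise. -/
def petrie (n : ℕ) (σ : ℕ → ℕ) : Matrix (Fin (n - 1)) (Fin (n - 1)) ℝ :=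
  Matrix.of fun i j =>
    if min (σ (i.1 + 1)) (σ (i.1 + 2)) ≤ j.1 + 1 ∧
        j.1 + 1 ≤ max (σ (i.1 + 1)) (σ (i.1 + 2)) - 1 then 1 else 0

/-- Two square real matrices are similar if `B = P * A * P⁻¹` for some invertible `P`. -/
def MatSimilar {m : Type*} [Fintype m] [DecidableEq m] (A B : Matrix m m ℝ) : Prop :=
  ∃ P : Matrix m m ℝ, IsUnit P ∧ B = P * A * P⁻¹

/-- `σ'` (a permutation of `P_{k+n}`) is a right extension of `σ` (a permutation of `P_k`). -/
def IsRightExt (k n : ℕ) (σ σ' : ℕ → ℕ) : Prop :=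
  IsPermOn (k + n) σ' ∧
  (∀ i, 1 ≤ i → i ≤ k - 1 → σ' i = σ i) ∧
  ∃ t, k + 1 ≤ t ∧ t ≤ k + n ∧ σ' t = σ k ∧
    ∀ j, j ≠ t → k ≤ j → j ≤ k + n → k < σ' j

/-- `(σ', ρ')` is a synchronized right extension of `(σ, ρ)` to `P_{k+n}`. -/
def IsSyncRightExt (k n : ℕ) (σ ρ σ' ρ' : ℕ → ℕ) : Prop :=
  IsRightExt k n σ σ' ∧ IsRightExt k n ρ ρ' ∧
  ∃ t, k + 1 ≤ t ∧ t ≤ k + n ∧ σ' t = σ k ∧ ρ' t = ρ k ∧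
    ∀ i, i ≠ t → k ≤ i → i ≤ k + n → σ' i = ρ' i

/-- `σ'` (a permutation of `P_{m+k}`) is a left extension of `σ` (a permutation of `P_k`). -/
def IsLeftExt (k m : ℕ) (σ σ' : ℕ → ℕ) : Prop :=
  IsPermOn (m + k) σ' ∧
  (∀ i, 2 ≤ i → i ≤ k → σ' (m + i) = m + σ i) ∧
  ∃ s, 1 ≤ s ∧ s ≤ m ∧ σ' s = m + σ 1 ∧
    ∀ j, j ≠ s → 1 ≤ j → j ≤ m + 1 → σ' j < m + 1

/-- `(σ', ρ')` is a synchronized left extension of `(σ, ρ)` to `P_{m+k}`. -/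
def IsSyncLeftExt (k m : ℕ) (σ ρ σ' ρ' : ℕ → ℕ) : Prop :=
  IsLeftExt k m σ σ' ∧ IsLeftExt k m ρ ρ' ∧
  ∃ s, 1 ≤ s ∧ s ≤ m ∧ σ' s = m + σ 1 ∧ ρ' s = m + ρ 1 ∧
    ∀ i, i ≠ s → 1 ≤ i → i ≤ m + 1 → σ' i = ρ' i

/-- `σ'` (a permutation of `P_{m+k+n}`) is a two-sided extension of `σ` (a permutation of `P_k`). -/
def IsTwoSidedExt (k m n : ℕ) (σ σ' : ℕ → ℕ) : Prop :=
  IsPermOn (m + k + n) σ' ∧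
  (∀ i, 2 ≤ i → i ≤ k - 1 → σ' (m + i) = m + σ i) ∧
  (∃ s, 1 ≤ s ∧ s ≤ m ∧ σ' s = m + σ 1 ∧
    ∀ i, i ≠ s → 1 ≤ i → i ≤ m + 1 → σ' i < m + 1) ∧
  (∃ t, m + k + 1 ≤ t ∧ t ≤ m + k + n ∧ σ' t = m + σ k ∧
    ∀ j, j ≠ t → m + k ≤ j → j ≤ m + k + n → m + k < σ' j)

/-- `(σ', ρ')` is a synchronized two-sided extension of `(σ, ρ)` to `P_{m+k+n}`. -/
def IsSyncTwoSidedExt (k m n : ℕ) (σ ρ σ' ρ' : ℕ → ℕ) : Prop :=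
  IsTwoSidedExt k m n σ σ' ∧ IsTwoSidedExt k m n ρ ρ' ∧
  ∃ s t, 1 ≤ s ∧ s ≤ m ∧ m + k + 1 ≤ t ∧ t ≤ m + k + n ∧
    σ' s = m + σ 1 ∧ ρ' s = m + ρ 1 ∧ σ' t = m + σ k ∧ ρ' t = m + ρ k ∧
    ∀ i, i ≠ s → i ≠ t →
      ((1 ≤ i ∧ i ≤ m + 1) ∨ (m + k ≤ i ∧ i ≤ m + k + n)) → σ' i = ρ' i

/-- `σ` and `ρ` (permutations of `P_k`) are right similar. -/
def RightSimilar (k : ℕ) (σ ρ : ℕ → ℕ) : Prop :=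
  ∀ n, 1 ≤ n → ∀ σ' ρ' : ℕ → ℕ, IsSyncRightExt k n σ ρ σ' ρ' →
    MatSimilar (petrie (k + n) σ') (petrie (k + n) ρ')

/-- `σ` and `ρ` (permutations of `P_k`) are left similar. -/
def LeftSimilar (k : ℕ) (σ ρ : ℕ → ℕ) : Prop :=
  ∀ m, 1 ≤ m → ∀ σ' ρ' : ℕ → ℕ, IsSyncLeftExt k m σ ρ σ' ρ' →
    MatSimilar (petrie (m + k) σ') (petrie (m + k) ρ')

/-- `σ` and `ρ` (permutations of `P_k`) are two-sided similar. -/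
def TwoSidedSimilar (k : ℕ) (σ ρ : ℕ → ℕ) : Prop :=
  ∀ m n, 1 ≤ m → 1 ≤ n → ∀ σ' ρ' : ℕ → ℕ, IsSyncTwoSidedExt k m n σ ρ σ' ρ' →
    MatSimilar (petrie (m + k + n) σ') (petrie (m + k + n) ρ')

/-- `σ` and `ρ` (permutations of `P_k`) are right weakly similar. -/
def RightWeaklySimilar (k : ℕ) (σ ρ : ℕ → ℕ) : Prop :=
  ∀ n, 1 ≤ n → ∀ σ' ρ' : ℕ → ℕ, IsSyncRightExt k n σ ρ σ' ρ' →
    (petrie (k + n) σ').charpoly = (petrie (k + n) ρ').charpoly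

/-- The cyclic permutation `σ_{n,k}` of `P_k`:
`σ_{n,k}(1) = n`, `σ_{n,k}(i) = i+1` for `n ≤ i ≤ k-1`, `σ_{n,k}(k) = n-1`,
and `σ_{n,k}(j) = j-1` for `2 ≤ j ≤ n-1`.
(For `n = 2` this is `1→2→⋯→k→1`; for `n = k` this is `1→k→k-1→⋯→2→1`.) -/
def sigmaNK (n k : ℕ) : ℕ → ℕ := fun i =>
  if i = 1 then n
  else if n ≤ i ∧ i ≤ k - 1 then i + 1
  else if i = k then n - 1
  else if 2 ≤ i ∧ i ≤ n - 1 then i - 1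
  else i

namespace PetrieAux

/-- Points: `X a` is the sum of the edges strictly to the left of the point `a`. -/
noncomputable def X (N : ℕ) (a : ℕ) : Fin (N - 1) → ℝ := fun j => if j.1 + 1 < a then 1 else 0

/-- Unsigned difference of two points. -/
noncomputable def D {V : Type*} [AddCommGroup V] (Y : ℕ → V) (a b : ℕ) : V :=
  if a ≤ b then Y b - Y a else Y a - Y b

theorem D_le {V : Type*} [AddCommGroup V] (Y : ℕ → V) {a b : ℕ} (h : a ≤ b) :
    D Y a b = Y b - Y a := by simp [D, h]

theorem D_ge {V : Type*} [AddCommGroup V] (Y : ℕ → V) {a b : ℕ} (h : b ≤ a) :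
    D Y a b = Y a - Y b := by
  unfold D
  split_ifs with h'
  · have : a = b := le_antisymm h' h
    simp [this]
  · rfl

theorem X_succ_sub (N i : ℕ) (h1 : 1 ≤ i) (h2 : i < N) :
    X N (i + 1) - X N i = Pi.single (⟨i - 1, by omega⟩ : Fin (N - 1)) 1 := by
  funext j
  simp only [X, Pi.sub_apply, Pi.single_apply, Fin.ext_iff]
  split_ifs <;> first | omega | norm_num

theorem X_one (N : ℕ) : X N 1 = 0 := by
  funext j; simp [X]

theorem petrie_row (N : ℕ) (σ : ℕ → ℕ) (hσ : ∀ i, 1 ≤ i → i ≤ N → 1 ≤ σ i) (i : Fin (N - 1)) :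
    petrie N σ i = D (X N) (σ (i.1 + 1)) (σ (i.1 + 2)) := by
  have h1 := hσ (i.1 + 1) (by omega) (by omega)
  have h2 := hσ (i.1 + 2) (by omega) (by omega)
  funext j
  simp only [petrie, D, Matrix.of_apply]
  split_ifs with h3 h4 h4 <;> simp only [X, Pi.sub_apply] <;> split_ifs <;>
    first | omega | norm_num

theorem vecMul_row {n : ℕ} (Y : ℕ → Fin (n - 1) → ℝ) (i : ℕ) (h1 : 1 ≤ i) (h2 : i < n) :
    (X n (i + 1) - X n i) ᵥ* (Matrix.of fun (i : Fin (n - 1)) => Y (i.1 + 2) - Y (i.1 + 1))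
      = Y (i + 1) - Y i := by
  rw [X_succ_sub n i h1 h2, Matrix.single_one_vecMul]
  obtain ⟨i, rfl⟩ : ∃ l, i = l + 1 := ⟨i - 1, by omega⟩
  rfl

theorem petrie_vecMul (N : ℕ) (σ : ℕ → ℕ) (hσ : ∀ i, 1 ≤ i → i ≤ N → 1 ≤ σ i)
    (i : ℕ) (h1 : 1 ≤ i) (h2 : i < N) :
    (petrie N σ).vecMulLinear (X N (i + 1) - X N i) = D (X N) (σ i) (σ (i + 1)) := by
  rw [Matrix.vecMulLinear_apply, X_succ_sub N i h1 h2, Matrix.single_one_vecMul]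
  have := petrie_row N σ hσ ⟨i - 1, by omega⟩
  obtain ⟨i, rfl⟩ : ∃ l, i = l + 1 := ⟨i - 1, by omega⟩
  exact this

theorem span_X (N : ℕ) (W : Submodule ℝ (Fin (N - 1) → ℝ))
    (h : ∀ i, 1 ≤ i → i < N → X N (i + 1) - X N i ∈ W) : W = ⊤ := by
  rw [eq_top_iff]
  intro v _
  rw [pi_eq_sum_univ' v]
  refine Submodule.sum_mem _ fun j _ => ?_
  refine Submodule.smul_mem _ _ ?_
  have := h (j.1 + 1) (by omega) (by omega)
  rw [X_succ_sub N _ (by omega) (by omega)] at this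
  convert this using 1
  funext l
  simp [Pi.single_apply, eq_comm]

theorem perm_isUnit (N : ℕ) (σ : ℕ → ℕ) (hσ : IsPermOn N σ) : IsUnit (petrie N σ) := by
  rw [← Matrix.vecMul_surjective_iff_isUnit]
  have hpos : ∀ i, 1 ≤ i → i ≤ N → 1 ≤ σ i := fun i a b => (hσ.1 ⟨a, b⟩).1
  have key : LinearMap.range (petrie N σ).vecMulLinear = ⊤ := by
    apply span_X
    set W := LinearMap.range (petrie N σ).vecMulLinear
    have hstep : ∀ i, 1 ≤ i → i < N → X N (σ (i + 1)) - X N (σ i) ∈ W := by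
      intro i h1 h2
      have h : D (X N) (σ i) (σ (i + 1)) ∈ W := ⟨_, petrie_vecMul N σ hpos i h1 h2⟩
      unfold D at h
      split_ifs at h
      · exact h
      · rw [← neg_sub]; exact W.neg_mem h
    have hall : ∀ i, 1 ≤ i → i ≤ N → X N (σ i) - X N (σ 1) ∈ W := by
      intro i h1
      induction i, h1 using Nat.le_induction with
      | base => intro _; simp
      | succ i h1 ih =>
        intro h2
        have := W.add_mem (hstep i h1 (by omega)) (ih (by omega))
        simpa using this
    have hall' : ∀ a, 1 ≤ a → a ≤ N → X N a - X N (σ 1) ∈ W := by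
      intro a h1 h2
      obtain ⟨i, hi, rfl⟩ := hσ.2.2 ⟨h1, h2⟩
      exact hall i hi.1 hi.2
    intro i h1 h2
    have := W.sub_mem (hall' (i + 1) (by omega) (by omega)) (hall' i (by omega) (by omega))
    simpa using this
  intro v
  have : v ∈ LinearMap.range (petrie N σ).vecMulLinear := by rw [key]; trivial
  exact this

theorem map_D {V W : Type*} [AddCommGroup V] [AddCommGroup W] [Module ℝ V] [Module ℝ W]
    (f : V →ₗ[ℝ] W) (Y : ℕ → V) (a b : ℕ) : f (D Y a b) = D (fun i => f (Y i)) a b := by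
  unfold D; split_ifs <;> simp

theorem similar_of_points (N : ℕ) (σ ρ : ℕ → ℕ) (hσ : IsPermOn N σ)
    (hρ : IsPermOn N ρ) (Y : ℕ → Fin (N - 1) → ℝ) (hY1 : Y 1 = 0)
    (hY : ∀ i, 1 ≤ i → i < N →
      (petrie N ρ).vecMulLinear (Y (i + 1) - Y i) = D Y (σ i) (σ (i + 1)))
    (hspan : ∀ W : Submodule ℝ (Fin (N - 1) → ℝ), (∀ a, 1 ≤ a → a ≤ N → Y a ∈ W) →
      (∀ v, (petrie N ρ).vecMulLinear v ∈ W → v ∈ W) → W = ⊤) :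
    MatSimilar (petrie N σ) (petrie N ρ) := by
  have hpos : ∀ i, 1 ≤ i → i ≤ N → 1 ≤ σ i := fun i a b => (hσ.1 ⟨a, b⟩).1
  set Q : Matrix (Fin (N - 1)) (Fin (N - 1)) ℝ :=
    Matrix.of fun (i : Fin (N - 1)) => Y (i.1 + 2) - Y (i.1 + 1) with hQ
  have hQX : ∀ a, 1 ≤ a → a ≤ N → Q.vecMulLinear (X N a) = Y a := by
    intro a h1
    induction a, h1 using Nat.le_induction with
    | base => intro _; rw [X_one, hY1, map_zero]
    | succ i h1 ih =>
      intro h2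
      have h3 := vecMul_row (n := N) Y i h1 (by omega)
      rw [← hQ, ← Matrix.vecMulLinear_apply, map_sub, ih (by omega)] at h3
      simpa using h3
  have hcomm : petrie N σ * Q = Q * petrie N ρ := by
    funext i
    rw [Matrix.mul_apply_eq_vecMul, Matrix.mul_apply_eq_vecMul, petrie_row N σ hpos,
      ← Matrix.vecMulLinear_apply, ← Matrix.vecMulLinear_apply, map_D]
    have h1 := hY (i.1 + 1) (by omega) (by omega)
    have h2 : Q i = Y (i.1 + 1 + 1) - Y (i.1 + 1) := rfl
    rw [h2, h1]
    have b1 := hσ.1 (show i.1 + 1 ∈ Set.Icc 1 N from ⟨by omega, by omega⟩)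
    have b2 := hσ.1 (show i.1 + 2 ∈ Set.Icc 1 N from ⟨by omega, by omega⟩)
    simp only [D, hQX _ b1.1 b1.2, hQX _ b2.1 b2.2]
  have hQu : IsUnit Q := by
    rw [← Matrix.vecMul_surjective_iff_isUnit]
    have key : LinearMap.range Q.vecMulLinear = ⊤ := by
      apply hspan
      · intro a h1 h2
        exact ⟨_, hQX a h1 h2⟩
      · rintro v ⟨u, hu⟩
        obtain ⟨u', hu'⟩ := (Matrix.vecMul_surjective_iff_isUnit.2 (perm_isUnit N σ hσ)) u
        have hinj := (Matrix.vecMul_injective_iff_isUnit.2 (perm_isUnit N ρ hρ))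
        refine ⟨u', hinj ?_⟩
        simp only [Matrix.vecMulLinear_apply] at hu ⊢
        simp only at hu'
        rw [← hu, Matrix.vecMul_vecMul, ← hcomm, ← Matrix.vecMul_vecMul, hu']
    intro v
    have : v ∈ LinearMap.range Q.vecMulLinear := by rw [key]; trivial
    exact this
  have hdet : IsUnit Q.det := (Matrix.isUnit_iff_isUnit_det _).1 hQu
  refine ⟨Q⁻¹, ?_, ?_⟩
  · exact (Matrix.isUnit_nonsing_inv_iff).2 hQu
  · rw [Matrix.nonsing_inv_nonsing_inv _ hdet, mul_assoc, hcomm, ← mul_assoc,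
      Matrix.nonsing_inv_mul _ hdet, one_mul]

theorem isPermOn_of_inj (N : ℕ) (σ : ℕ → ℕ) (h1 : ∀ i, 1 ≤ i → i ≤ N → 1 ≤ σ i ∧ σ i ≤ N)
    (h2 : ∀ i j, 1 ≤ i → i ≤ N → 1 ≤ j → j ≤ N → σ i = σ j → i = j) : IsPermOn N σ := by
  have hm : Set.MapsTo σ (Set.Icc 1 N) (Set.Icc 1 N) := fun i hi => h1 i hi.1 hi.2
  have hi : Set.InjOn σ (Set.Icc 1 N) := fun i hi j hj h => h2 i j hi.1 hi.2 hj.1 hj.2 h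
  refine ⟨hm, hi, ?_⟩
  have := Finset.surjOn_of_injOn_of_card_le (s := Finset.Icc 1 N) (t := Finset.Icc 1 N) σ
    (by simpa using hm) (by simpa using hi) le_rfl
  simpa using this

theorem trace_eq_of_similar {n : ℕ} {A B : Matrix (Fin n) (Fin n) ℝ} (h : MatSimilar A B) :
    A.trace = B.trace := by
  obtain ⟨P, hP, rfl⟩ := h
  have hdet : IsUnit P.det := (Matrix.isUnit_iff_isUnit_det _).1 hP
  rw [Matrix.trace_mul_comm, ← mul_assoc, Matrix.nonsing_inv_mul _ hdet, one_mul]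

theorem trace_eq_one {N : ℕ} (σ : ℕ → ℕ) (r : ℕ) (hr : r + 1 < N)
    (h0 : min (σ (r + 1)) (σ (r + 2)) ≤ r + 1 ∧ r + 1 ≤ max (σ (r + 1)) (σ (r + 2)) - 1)
    (h : ∀ i, i + 1 < N → i ≠ r →
      ¬ (min (σ (i + 1)) (σ (i + 2)) ≤ i + 1 ∧ i + 1 ≤ max (σ (i + 1)) (σ (i + 2)) - 1)) :
    (petrie N σ).trace = 1 := by
  unfold Matrix.trace
  rw [Finset.sum_eq_single (⟨r, by omega⟩ : Fin (N - 1))]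
  · simp only [petrie, Matrix.diag_apply, Matrix.of_apply]
    rw [if_pos h0]
  · intro i _ hi
    simp only [petrie, Matrix.diag_apply, Matrix.of_apply]
    rw [if_neg (h i.1 (by omega) (by simpa [Fin.ext_iff] using hi))]
  · simp

theorem two_le_trace {N : ℕ} (σ : ℕ → ℕ) (r s : ℕ) (hrs : r < s) (hs : s + 1 < N)
    (h0 : min (σ (r + 1)) (σ (r + 2)) ≤ r + 1 ∧ r + 1 ≤ max (σ (r + 1)) (σ (r + 2)) - 1)
    (h1 : min (σ (s + 1)) (σ (s + 2)) ≤ s + 1 ∧ s + 1 ≤ max (σ (s + 1)) (σ (s + 2)) - 1) :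
    2 ≤ (petrie N σ).trace := by
  unfold Matrix.trace
  have hne : (⟨r, by omega⟩ : Fin (N - 1)) ≠ ⟨s, by omega⟩ := by
    simp [Fin.ext_iff]; omega
  have := Finset.sum_le_sum_of_subset_of_nonneg
    (f := fun i => (petrie N σ).diag i)
    (Finset.subset_univ {(⟨r, by omega⟩ : Fin (N - 1)), (⟨s, by omega⟩ : Fin (N - 1))})
    (by
      intro i _ _
      simp only [petrie, Matrix.diag_apply, Matrix.of_apply]
      split_ifs <;> norm_num)
  rw [Finset.sum_pair hne] at this
  refine le_trans ?_ this
  simp only [petrie, Matrix.diag_apply, Matrix.of_apply]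
  rw [if_pos h0, if_pos h1]
  norm_num

theorem not_right (k : ℕ) (hk : 4 ≤ k) : ¬ RightSimilar k (sigmaNK 2 k) (sigmaNK k k) := by
  intro h
  have h := h 1 le_rfl (fun i => if i = k + 1 then 1 else i + 1)
    (fun i => if i = 1 then k else if i < k then i - 1 else if i = k then k + 1 else k - 1) (by
      refine ⟨⟨?_, ?_, k + 1, ?_⟩, ⟨?_, ?_, k + 1, ?_⟩, k + 1, ?_⟩
      · apply isPermOn_of_inj <;> grind
      · grind [sigmaNK]
      · grind [sigmaNK]
      · apply isPermOn_of_inj <;> grind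
      · grind [sigmaNK]
      · grind [sigmaNK]
      · grind [sigmaNK])
  have h := trace_eq_of_similar h
  rw [trace_eq_one _ (k - 1) (by omega) (by grind) (by grind)] at h
  have := two_le_trace (N := k + 1)
    (fun i => if i = 1 then k else if i < k then i - 1 else if i = k then k + 1 else k - 1)
    0 (k - 1) (by omega) (by omega) (by grind) (by grind)
  linarith

theorem not_left (k : ℕ) (hk : 4 ≤ k) : ¬ LeftSimilar k (sigmaNK 2 k) (sigmaNK k k) := by
  intro h
  have h := h 1 le_rfl
    (fun i => if i = 1 then 3 else if i = 2 then 1 else if i ≤ k then i + 1 else 2)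
    (fun i => if i = 1 then k + 1 else i - 1) (by
      refine ⟨⟨?_, ?_, 1, ?_⟩, ⟨?_, ?_, 1, ?_⟩, 1, ?_⟩
      · apply isPermOn_of_inj <;> grind
      · grind [sigmaNK]
      · grind [sigmaNK]
      · apply isPermOn_of_inj <;> grind
      · grind [sigmaNK]
      · grind [sigmaNK]
      · grind [sigmaNK])
  have h := trace_eq_of_similar h
  rw [trace_eq_one (fun i => if i = 1 then k + 1 else i - 1) 0 (by omega)
    (by grind) (by grind)] at h
  have := two_le_trace (N := 1 + k)
    (fun i => if i = 1 then 3 else if i = 2 then 1 else if i ≤ k then i + 1 else 2)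
    0 1 (by omega) (by omega) (by grind) (by grind)
  linarith

theorem plain (k : ℕ) (hk : 4 ≤ k) :
    MatSimilar (petrie k (sigmaNK 2 k)) (petrie k (sigmaNK k k)) := by
  have hρ : IsPermOn k (sigmaNK k k) := by apply isPermOn_of_inj <;> grind [sigmaNK]
  have hpos : ∀ i, 1 ≤ i → i ≤ k → 1 ≤ sigmaNK k k i := fun i a b => (hρ.1 ⟨a, b⟩).1
  refine similar_of_points k _ _ (by apply isPermOn_of_inj <;> grind [sigmaNK]) hρ
    (fun a => X k k - X k (k + 1 - a)) (by simp) ?_ ?_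
  · intro i h1 h2
    have h := petrie_vecMul k _ hpos (k - i) (by omega) (by omega)
    have e1 : k + 1 - i = k - i + 1 := by omega
    have e2 : k + 1 - (i + 1) = k - i := by omega
    have e3 : X k k - X k (k + 1 - (i + 1)) - (X k k - X k (k + 1 - i))
        = X k (k - i + 1) - X k (k - i) := by
      rw [e1, e2]; abel
    rw [e3, h]
    by_cases hi : i = k - 1
    · subst hi
      have a1 : sigmaNK 2 k (k - 1) = k := by grind [sigmaNK]
      have a2 : sigmaNK 2 k (k - 1 + 1) = 1 := by grind [sigmaNK]
      have a3 : sigmaNK k k (k - (k - 1)) = k := by grind [sigmaNK]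
      have a4 : sigmaNK k k (k - (k - 1) + 1) = 1 := by grind [sigmaNK]
      rw [a1, a2, a3, a4, D_ge _ (by omega), D_ge _ (by omega)]
      simp
    · have a1 : sigmaNK 2 k i = i + 1 := by grind [sigmaNK]
      have a2 : sigmaNK 2 k (i + 1) = i + 2 := by grind [sigmaNK]
      have a3 : sigmaNK k k (k - i) = k - i - 1 := by grind [sigmaNK]
      have a4 : sigmaNK k k (k - i + 1) = k - i := by grind [sigmaNK]
      rw [a1, a2, a3, a4, D_le _ (by omega), D_le _ (by omega)]
      have e4 : k + 1 - (i + 2) = k - i - 1 := by omega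
      simp only [e2, e4]
      abel
  · intro W hW _
    apply span_X
    intro i h1 h2
    have := W.sub_mem (hW (k + 1 - i) (by omega) (by omega))
      (hW (k - i) (by omega) (by omega))
    have e1 : k + 1 - (k + 1 - i) = i := by omega
    have e2 : k + 1 - (k - i) = i + 1 := by omega
    simpa [e1, e2] using this

theorem two_sided_core (k m n : ℕ) (hk : 4 ≤ k) (σ ρ : ℕ → ℕ)
    (hσ : IsPermOn (m + k + n) σ) (hρ : IsPermOn (m + k + n) ρ) (s t : ℕ)
    (hs1 : 1 ≤ s) (hs2 : s ≤ m) (ht1 : m + k + 1 ≤ t) (ht2 : t ≤ m + k + n)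
    (σs : σ s = m + 2) (ρs : ρ s = m + k) (σt : σ t = m + 1) (ρt : ρ t = m + k - 1)
    (mid : ∀ i, m + 2 ≤ i → i ≤ m + k - 1 → σ i = i + 1 ∧ ρ i = i - 1)
    (left : ∀ i, i ≠ s → 1 ≤ i → i ≤ m + 1 → ρ i = σ i ∧ σ i ≤ m)
    (right : ∀ i, i ≠ t → m + k ≤ i → i ≤ m + k + n → ρ i = σ i ∧ m + k < σ i) :
    MatSimilar (petrie (m + k + n) σ) (petrie (m + k + n) ρ) := by
  have hpos : ∀ i, 1 ≤ i → i ≤ m + k + n → 1 ≤ ρ i := fun i a b => (hρ.1 ⟨a, b⟩).1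
  have hrow := petrie_vecMul (m + k + n) ρ hpos
  set B := (petrie (m + k + n) ρ).vecMulLinear with hB
  set x := X (m + k + n) with hx
  obtain ⟨a0, ha0⟩ : ∃ a, a = ρ (m + 1) := ⟨_, rfl⟩
  obtain ⟨b, hb⟩ : ∃ b, b = ρ (m + k) := ⟨_, rfl⟩
  have hL := left (m + 1) (by omega) (by omega) (by omega)
  have hR := right (m + k) (by omega) (by omega) (by omega)
  -- rows of the middle part
  have hmid : ∀ p, m + 1 ≤ p → p ≤ m + k - 1 →
      B (x (p + 1) - x p) = x (ρ (p + 1)) - x (ρ p) := by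
    intro p h1 h2
    rw [hrow p (by omega) (by omega), D_le]
    by_cases e1 : p = m + 1
    · subst e1
      have := mid (m + 1 + 1) (by omega) (by omega)
      omega
    · have h3 := mid p (by omega) (by omega)
      by_cases e2 : p = m + k - 1
      · have e3 : p + 1 = m + k := by omega
        rw [e3]; omega
      · have h4 := mid (p + 1) (by omega) (by omega)
        omega
  have htel : ∀ j, j + 2 ≤ k →
      B (x (m + k) - x (m + k - 1 - j)) = x b - x (ρ (m + k - 1 - j)) := by
    intro j
    induction j with
    | zero =>
      intro _
      have := hmid (m + k - 1) (by omega) (by omega)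
      have e : m + k - 1 + 1 = m + k := by omega
      rw [e] at this
      simpa [hb] using this
    | succ j ih =>
      intro hj
      have h1 := ih (by omega)
      have h2 := hmid (m + k - 1 - (j + 1)) (by omega) (by omega)
      have e : m + k - 1 - (j + 1) + 1 = m + k - 1 - j := by omega
      rw [e] at h2
      have e2 : x (m + k) - x (m + k - 1 - (j + 1)) = (x (m + k) - x (m + k - 1 - j)) +
        (x (m + k - 1 - j) - x (m + k - 1 - (j + 1))) := by abel
      rw [e2, map_add, h1, h2]
      abel
  set u := x b - x (m + k) with hu
  -- consistency at the point `m + k`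
  have hcons : ∀ j, j + 2 ≤ k → (B ^ j) (x (m + k) - x (m + k - 1)) =
      x (m + k) - x (m + k - 1 - j) + ∑ i ∈ Finset.range j, (B ^ i) u := by
    intro j
    induction j with
    | zero => intro _; simp
    | succ j ih =>
      intro hj
      have h0 := htel j (by omega)
      have h1 := (mid (m + k - 1 - j) (by omega) (by omega)).2
      rw [pow_succ', Module.End.mul_apply, ih (by omega), map_add, h0, h1, map_sum,
        Finset.sum_range_succ']
      have e : m + k - 1 - j - 1 = m + k - 1 - (j + 1) := by omega
      simp only [pow_succ', Module.End.mul_apply, pow_zero, Module.End.one_apply]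
      rw [e, hu]
      abel
  set Y : ℕ → Fin (m + k + n - 1) → ℝ := fun a =>
    if a ≤ m + 1 then x a
    else if a ≤ m + k then x (m + k) + ∑ i ∈ Finset.range (a - (m + 2)), (B ^ i) u
    else x (m + 1) + (B ^ (k - 2)) (x a - x (m + k - 1)) with hYdef
  have Yl : ∀ a, a ≤ m + 1 → Y a = x a := by
    intro a h; simp only [hYdef]; rw [if_pos h]
  have Ym : ∀ j, j + 2 ≤ k → Y (m + 2 + j) = x (m + k) + ∑ i ∈ Finset.range j, (B ^ i) u := by
    intro j h
    simp only [hYdef]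
    rw [if_neg (by omega), if_pos (by omega)]
    congr 3
    omega
  have Yr : ∀ a, m + k ≤ a → Y a = x (m + 1) + (B ^ (k - 2)) (x a - x (m + k - 1)) := by
    intro a h
    rcases h.eq_or_lt with rfl | h
    · have h1 := Ym (k - 2) (by omega)
      have e : m + 2 + (k - 2) = m + k := by omega
      have e2 : m + k - 1 - (k - 2) = m + 1 := by omega
      rw [e] at h1
      rw [h1, hcons (k - 2) (by omega), e2]
      abel
    · simp only [hYdef]
      rw [if_neg (by omega), if_neg (by omega)]
  have Yσl : ∀ i, 1 ≤ i → i ≤ m + 1 → Y (σ i) = x (ρ i) := by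
    intro i h1 h2
    by_cases e : i = s
    · subst e
      have := Ym 0 (by omega)
      rw [σs, ρs]
      simpa using this
    · have := left i e h1 h2
      rw [this.1, Yl _ (by omega)]
  have Yσr : ∀ i, m + k ≤ i → i ≤ m + k + n →
      Y (σ i) = x (m + 1) + (B ^ (k - 2)) (x (ρ i) - x (m + k - 1)) := by
    intro i h1 h2
    by_cases e : i = t
    · subst e
      rw [σt, ρt, Yl _ le_rfl]
      simp
    · have := right i e h1 h2
      rw [this.1, Yr _ (by omega)]
  refine similar_of_points (m + k + n) σ ρ hσ hρ Y ?_ ?_ ?_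
  · rw [Yl 1 (by omega), hx, X_one]
  · intro i h1 h2
    rw [← hB]
    by_cases c1 : i ≤ m
    · rw [Yl _ (by omega), Yl _ (by omega), hrow i h1 h2]
      have hiff : (ρ i ≤ ρ (i + 1)) ↔ (σ i ≤ σ (i + 1)) := by
        by_cases e : i = s
        · have := left (i + 1) (by omega) (by omega) (by omega)
          subst e
          omega
        · have := left i e (by omega) (by omega)
          by_cases e' : i + 1 = s
          · subst e'
            omega
          · have := left (i + 1) e' (by omega) (by omega)
            omega
      unfold D
      simp only [hiff, Yσl i h1 (by omega), Yσl (i + 1) (by omega) (by omega)]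
    by_cases c2 : i = m + 1
    · subst c2
      have h3 := (mid (m + 2) (by omega) (by omega)).1
      have h4 := htel (k - 2) (by omega)
      have e2 : m + k - 1 - (k - 2) = m + 1 := by omega
      rw [e2] at h4
      have y2 := Ym 0 (by omega)
      have y3 := Ym 1 (by omega)
      simp at y2 y3
      have e3 : m + 1 + 1 = m + 2 := by omega
      have e4 : m + 2 + 1 = m + 3 := by omega
      rw [e3, h3, y2, Yl _ le_rfl, h4, D_le _ (by omega), y3, Yσl _ (by omega) le_rfl, hu]
      abel
    by_cases c3 : i ≤ m + k - 2
    · obtain ⟨j, rfl⟩ : ∃ j, i = m + 2 + j := ⟨i - (m + 2), by omega⟩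
      have h3 := (mid (m + 2 + j) (by omega) (by omega)).1
      have h4 := (mid (m + 2 + j + 1) (by omega) (by omega)).1
      have y0 := Ym j (by omega)
      have y1 := Ym (j + 1) (by omega)
      have y2 := Ym (j + 2) (by omega)
      rw [← add_assoc] at y1 y2
      have e : m + 2 + j + 1 + 1 = m + 2 + j + 2 := by omega
      rw [h3, h4, D_le _ (by omega), e, y0, y1, y2, Finset.sum_range_succ _ (j + 1),
        Finset.sum_range_succ _ j]
      have e5 : (B ^ (j + 1)) u = B ((B ^ j) u) := by
        rw [pow_succ', Module.End.mul_apply]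
      rw [e5]
      simp
    by_cases c4 : i = m + k - 1
    · have e : i = m + 2 + (k - 3) := by omega
      have h3 := (mid i (by omega) (by omega)).1
      have e1 : i + 1 = m + k := by omega
      have y0 := Ym (k - 3) (by omega)
      have y1 := Ym (k - 3 + 1) (by omega)
      have e2 : m + 2 + (k - 3 + 1) = m + k := by omega
      rw [e2, Finset.sum_range_succ] at y1
      rw [← e] at y0
      have e5 : (B ^ (k - 2)) u = B ((B ^ (k - 3)) u) := by
        have : k - 2 = k - 3 + 1 := by omega
        rw [this, pow_succ', Module.End.mul_apply]
      have hD : D Y (σ i) (σ (i + 1)) = (B ^ (k - 2)) u := by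
        rw [h3, e1, D_le _ (by omega), Yσr _ (by omega) (by omega), Yr _ le_rfl, ← hb, hu]
        simp only [map_sub]
        abel
      rw [hD, e5, e1, y0, y1]
      simp
    · have c5 : m + k ≤ i := by omega
      rw [Yr _ c5, Yr _ (by omega)]
      have e : x (m + 1) + (B ^ (k - 2)) (x (i + 1) - x (m + k - 1)) -
          (x (m + 1) + (B ^ (k - 2)) (x i - x (m + k - 1))) =
          (B ^ (k - 2)) (x (i + 1) - x i) := by
        simp only [map_sub]; abel
      have e' : B ((B ^ (k - 2)) (x (i + 1) - x i)) = (B ^ (k - 2)) (B (x (i + 1) - x i)) := by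
        rw [← Module.End.mul_apply, ← Module.End.mul_apply, ← pow_succ, ← pow_succ']
      rw [e, e', hrow i h1 h2, map_D]
      have hiff : (ρ i ≤ ρ (i + 1)) ↔ (σ i ≤ σ (i + 1)) := by
        by_cases e : i = t
        · have := right (i + 1) (by omega) (by omega) (by omega)
          subst e
          omega
        · have := right i e (by omega) (by omega)
          by_cases e' : i + 1 = t
          · subst e'
            omega
          · have := right (i + 1) e' (by omega) (by omega)
            omega
      unfold D
      simp only [hiff, Yσr i c5 (by omega), Yσr (i + 1) (by omega) (by omega)]
      simp only [map_sub]
      split_ifs <;> abel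
  · intro W hY hBW
    rw [← hB] at hBW
    have hpow : ∀ j v, (B ^ j) v ∈ W → v ∈ W := by
      intro j
      induction j with
      | zero => intro v h; simpa using h
      | succ j ih =>
        intro v h
        rw [pow_succ', Module.End.mul_apply] at h
        exact ih _ (hBW _ h)
    have wl : ∀ a, 1 ≤ a → a ≤ m + 1 → x a ∈ W := by
      intro a h1 h2
      rw [← Yl a h2]
      exact hY a h1 (by omega)
    have wk : x (m + k) ∈ W := by
      have y2 := Ym 0 (by omega)
      simp at y2
      rw [← y2]
      exact hY _ (by omega) (by omega)
    have wr' : ∀ a, m + k ≤ a → a ≤ m + k + n → x a - x (m + k - 1) ∈ W := by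
      intro a h1 h2
      have h3 := hY a (by omega) h2
      rw [Yr a h1] at h3
      exact hpow _ _ ((W.add_mem_iff_right (wl (m + 1) (by omega) le_rfl)).1 h3)
    have wk1 : x (m + k - 1) ∈ W := by
      have := W.sub_mem wk (wr' (m + k) le_rfl (by omega))
      simpa using this
    have wr : ∀ a, m + k ≤ a → a ≤ m + k + n → x a ∈ W := by
      intro a h1 h2
      have := W.add_mem (wr' a h1 h2) wk1
      simpa using this
    have wm : ∀ a, 1 ≤ a → a ≤ m + k - 1 → x a ∈ W := by
      intro a
      induction a using Nat.strong_induction_on with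
      | _ a ih =>
        intro h1 h2
        by_cases c : a ≤ m + 1
        · exact wl a h1 c
        · obtain ⟨p, rfl⟩ : ∃ p, a = p + 1 := ⟨a - 1, by omega⟩
          have h3 := hmid p (by omega) (by omega)
          have h4 := (mid (p + 1) (by omega) (by omega)).2
          have h5 : 1 ≤ ρ p ∧ ρ p ≤ p := by
            refine ⟨hpos p (by omega) (by omega), ?_⟩
            by_cases c' : p = m + 1
            · subst c'; omega
            · have := (mid p (by omega) (by omega)).2
              omega
          have h6 : x (p + 1) - x p ∈ W := by
            apply hBW
            rw [h3, h4]
            exact W.sub_mem (ih _ (by omega) (by omega) (by omega))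
              (ih _ (by omega) (by omega) (by omega))
          have := W.add_mem h6 (ih p (by omega) (by omega) (by omega))
          simpa using this
    have wall : ∀ a, 1 ≤ a → a ≤ m + k + n → x a ∈ W := by
      intro a h1 h2
      by_cases c : m + k ≤ a
      · exact wr a c h2
      · exact wm a h1 (by omega)
    apply span_X
    intro i h1 h2
    exact W.sub_mem (wall _ (by omega) (by omega)) (wall _ h1 (by omega))

theorem two_sided (k : ℕ) (hk : 4 ≤ k) : TwoSidedSimilar k (sigmaNK 2 k) (sigmaNK k k) := by
  intro m n hm hn σ ρ h
  obtain ⟨⟨hσ, mσ, ⟨s1, _, _, _, ls⟩, ⟨t1, _, _, _, rs⟩⟩, ⟨hρ, mρ, -, -⟩,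
    s, t, hs1, hs2, ht1, ht2, σs, ρs, σt, ρt, heq⟩ := h
  have v1 : sigmaNK 2 k 1 = 2 := by grind [sigmaNK]
  have v2 : sigmaNK 2 k k = 1 := by grind [sigmaNK]
  have v3 : sigmaNK k k 1 = k := by grind [sigmaNK]
  have v4 : sigmaNK k k k = k - 1 := by grind [sigmaNK]
  rw [v1] at σs
  rw [v2] at σt
  rw [v3] at ρs
  rw [v4] at ρt
  have es : s = s1 := by
    by_contra hne
    have := ls s hne hs1 (by omega)
    omega
  have et : t = t1 := by
    by_contra hne
    have := rs t hne (by omega) (by omega)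
    omega
  subst es et
  refine two_sided_core k m n hk σ ρ hσ hρ s t hs1 hs2 ht1 ht2 σs ρs σt (by omega) ?_ ?_ ?_
  · intro i h1 h2
    obtain ⟨j, rfl⟩ : ∃ j, i = m + j := ⟨i - m, by omega⟩
    have a1 := mσ j (by omega) (by omega)
    have a2 := mρ j (by omega) (by omega)
    have w1 : sigmaNK 2 k j = j + 1 := by grind [sigmaNK]
    have w2 : sigmaNK k k j = j - 1 := by grind [sigmaNK]
    omega
  · intro i h1 h2 h3
    have a1 := ls i h1 h2 h3
    have a2 := heq i h1 (by omega) (Or.inl ⟨h2, h3⟩)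
    omega
  · intro i h1 h2 h3
    have a1 := rs i h1 h2 h3
    have a2 := heq i (by omega) h1 (Or.inr ⟨h2, h3⟩)
    omega

end PetrieAux

/-- Theorem 8(4). -/
theorem sigma2K_sigmaKK_similar (k : ℕ) (hk : 4 ≤ k) :
    TwoSidedSimilar k (sigmaNK 2 k) (sigmaNK k k) ∧
    ¬ RightSimilar k (sigmaNK 2 k) (sigmaNK k k) ∧
    ¬ LeftSimilar k (sigmaNK 2 k) (sigmaNK k k) ∧
    MatSimilar (petrie k (sigmaNK 2 k)) (petrie k (sigmaNK k k)) := by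
  exact ⟨PetrieAux.two_sided k hk, PetrieAux.not_right k hk, PetrieAux.not_left k hk,
    PetrieAux.plain k hk⟩
end

section
/- Let k > j ≥ 3 be integers and let σ, ρ be permutations of P_k such that: (a) there exists an integer 1 ≤ s ≤ j−2 with σ(s) = j and ρ(s) = k; (b) σ(x) = ρ(x) ≤ j−1 for all 1 ≤ x ≤ j−1 with x ≠ s; (c) σ(x) = x+1 for all j ≤ x ≤ k−1; (d) ρ(x) = x−1 for all j+1 ≤ x ≤ k; (e) σ(j−1) = ρ(j−1) < σ(k) = ρ(j) ≤ j−1. Then σ and ρ are right similar and two-sided similar, but not left similar; moreover the Petrie matrices M_σ and M_ρ are not similar over ℝ, since they have distinct traces. -/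
open Matrix

/-- Indicator vector of the edges to the left of vertex `x`. -/
def wv (N x : ℕ) : Fin (N - 1) → ℝ := fun y => if y.1 + 1 < x then 1 else 0

/-- The orientation of the image of an edge. -/
noncomputable def epsv (ρ : ℕ → ℕ) (i : ℕ) : ℝ := if ρ (i + 1) < ρ (i + 2) then 1 else -1

lemma petrie_row (N : ℕ) (σ : ℕ → ℕ) (i : Fin (N - 1)) :
    petrie N σ i = epsv σ i.1 • (wv N (σ (i.1 + 2)) - wv N (σ (i.1 + 1))) := by
  funext y
  simp only [petrie, Matrix.of_apply, Pi.smul_apply, Pi.sub_apply, smul_eq_mul, wv, epsv]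
  generalize σ (i.1 + 1) = p
  generalize σ (i.1 + 2) = q
  rcases lt_or_ge p q with h | h
  · rw [min_eq_left h.le, max_eq_right h.le, if_pos h]
    by_cases h1 : y.1 + 1 < p <;> by_cases h2 : y.1 + 1 < q
    · rw [if_neg (by omega)]; simp [h1, h2]
    · omega
    · rw [if_pos (by omega)]; simp [h1, h2]
    · rw [if_neg (by omega)]; simp [h1, h2]
  · rw [min_eq_right h, max_eq_left h, if_neg (show ¬ p < q by omega)]
    by_cases h1 : y.1 + 1 < p <;> by_cases h2 : y.1 + 1 < q
    · rw [if_neg (by omega)]; simp [h1, h2]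
    · rw [if_pos (by omega)]; simp [h1, h2]
    · omega
    · rw [if_neg (by omega)]; simp [h1, h2]

lemma wv_one (N : ℕ) : wv N 1 = 0 := by
  funext y; simp [wv]

lemma wv_succ (N x : ℕ) (hx : x < N - 1) :
    wv N (x + 2) = wv N (x + 1) + Pi.single (⟨x, hx⟩ : Fin (N - 1)) 1 := by
  funext y
  simp only [wv, Pi.add_apply, Pi.single_apply, Fin.ext_iff]
  rcases lt_trichotomy y.1 x with h | h | h
  · rw [if_pos (by omega), if_pos (by omega), if_neg (by omega)]; simp
  · rw [if_pos (by omega), if_neg (by omega), if_pos (by omega)]; simp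
  · rw [if_neg (by omega), if_neg (by omega), if_neg (by omega)]; simp

lemma vecMul_wv (N : ℕ) (P : Matrix (Fin (N - 1)) (Fin (N - 1)) ℝ) (x : ℕ) (hx : x < N - 1) :
    (wv N (x + 2)) ᵥ* P - (wv N (x + 1)) ᵥ* P = P ⟨x, hx⟩ := by
  rw [wv_succ N x hx, Matrix.add_vecMul, Matrix.single_one_vecMul]
  simp [Matrix.row]

lemma vecMul_wv_of (N : ℕ) (G : ℕ → Fin (N - 1) → ℝ) (x : ℕ) (hx : x + 1 ≤ N) :
    (wv N (x + 1)) ᵥ* (Matrix.of fun i : Fin (N - 1) => G (i.1 + 2) - G (i.1 + 1)) =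
      G (x + 1) - G 1 := by
  induction x with
  | zero => simp [wv_one]
  | succ x ih =>
    have h := vecMul_wv N (Matrix.of fun i : Fin (N - 1) => G (i.1 + 2) - G (i.1 + 1)) x (by omega)
    have h2 := ih (by omega)
    rw [h2] at h
    have h3 : (Matrix.of fun i : Fin (N - 1) => G (i.1 + 2) - G (i.1 + 1)) ⟨x, by omega⟩ =
      G (x + 2) - G (x + 1) := rfl
    rw [h3] at h
    have := eq_add_of_sub_eq h
    rw [this]; abel

lemma epsv_congr (σ ρ : ℕ → ℕ) (i : ℕ)
    (h : σ (i + 1) < σ (i + 2) ↔ ρ (i + 1) < ρ (i + 2)) : epsv σ i = epsv ρ i := by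
  simp only [epsv, h]

lemma matSimilar_of {m : Type*} [Fintype m] [DecidableEq m] {A B P : Matrix m m ℝ}
    (hP : IsUnit P) (h : A * P = P * B) : MatSimilar A B := by
  have hd : IsUnit P.det := (Matrix.isUnit_iff_isUnit_det P).1 hP
  refine ⟨P⁻¹, (Matrix.isUnit_nonsing_inv_iff).2 hP, ?_⟩
  rw [Matrix.nonsing_inv_nonsing_inv P hd, Matrix.mul_assoc, h, ← Matrix.mul_assoc,
    Matrix.nonsing_inv_mul P hd, Matrix.one_mul]

lemma matSimilar_refl {m : Type*} [Fintype m] [DecidableEq m] (A : Matrix m m ℝ) :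
    MatSimilar A A := ⟨1, isUnit_one, by simp⟩

lemma matSimilar_trans {m : Type*} [Fintype m] [DecidableEq m] {A B C : Matrix m m ℝ}
    (h1 : MatSimilar A B) (h2 : MatSimilar B C) : MatSimilar A C := by
  obtain ⟨P, hP, rfl⟩ := h1
  obtain ⟨Q, hQ, rfl⟩ := h2
  exact ⟨Q * P, hQ.mul hP, by rw [Matrix.mul_inv_rev]; simp only [Matrix.mul_assoc]⟩

lemma matSimilar_trace {m : Type*} [Fintype m] [DecidableEq m] {A B : Matrix m m ℝ}
    (h1 : MatSimilar A B) : A.trace = B.trace := by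
  obtain ⟨P, hP, rfl⟩ := h1
  have hd : IsUnit P.det := (Matrix.isUnit_iff_isUnit_det P).1 hP
  rw [Matrix.trace_mul_comm, ← Matrix.mul_assoc, Matrix.nonsing_inv_mul P hd, Matrix.one_mul]

lemma petrie_congr (N : ℕ) (σ ρ : ℕ → ℕ) (h : ∀ x, 1 ≤ x → x ≤ N → σ x = ρ x) :
    petrie N σ = petrie N ρ := by
  ext i y
  simp only [petrie, Matrix.of_apply]
  rw [h (i.1 + 1) (by omega) (by omega), h (i.1 + 2) (by omega) (by omega)]

/-- Moving the pivot by one vertex is a similarity. -/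
lemma one_step (N a s t : ℕ) (σ ρ : ℕ → ℕ) (hs : 1 ≤ s) (hsa : s + 2 ≤ a) (hta : a + 2 ≤ t)
    (htN : t ≤ N) (h1 : σ s = a) (h2 : ρ s = a + 1) (h3 : σ a = a + 1) (h4 : σ t = ρ a)
    (h5 : ρ t = a) (h6 : ρ a < a) (h7 : σ (a - 1) < ρ a)
    (hlt : ∀ x, 1 ≤ x → x < a → x ≠ s → σ x = ρ x ∧ 1 ≤ σ x ∧ σ x < a)
    (hgt : ∀ x, a < x → x ≤ N → x ≠ t → σ x = ρ x ∧ a + 1 < σ x ∧ σ x ≤ N)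
    (hsurj : ∀ z, a + 2 ≤ z → z ≤ N → ∃ x, a < x ∧ x ≤ N ∧ ρ x = z) :
    MatSimilar (petrie N σ) (petrie N ρ) := by
  have heps : ∀ i, i < N - 1 → epsv σ i = epsv ρ i := by
    intro i hi
    apply epsv_congr
    have key : ∀ x y, y = x + 1 → 1 ≤ x → y ≤ N → (σ x < σ y ↔ ρ x < ρ y) := by
      intro x y hxy hx hy
      rcases lt_trichotomy x a with hxa | hxa | hxa
      · by_cases hya : y = a
        · have hx' : x = a - 1 := by omega
          have := hlt x hx hxa (by omega)
          rw [← hx'] at h7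
          subst hya
          omega
        · by_cases hxs : x = s
          · have := hlt y (by omega) (by omega) (by omega)
            subst hxs; omega
          · have := hlt x hx hxa hxs
            by_cases hys : y = s
            · subst hys; omega
            · have := hlt y (by omega) (by omega) hys
              omega
      · have := hgt y (by omega) hy (by omega)
        subst hxa; omega
      · by_cases hxt : x = t
        · have := hgt y (by omega) hy (by omega)
          subst hxt; omega
        · have := hgt x hxa (by omega) hxt
          by_cases hyt : y = t
          · subst hyt; omega
          · have := hgt y (by omega) hy hyt
            omega
    exact key _ _ rfl (by omega) (by omega)
  set M := petrie N ρ with hM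
  set R : ℕ → Fin (N - 1) → ℝ := fun y => (wv N y) ᵥ* M with hR
  have hRdiff : ∀ i, i < N - 1 →
      R (i + 2) - R (i + 1) = epsv ρ i • (wv N (ρ (i + 2)) - wv N (ρ (i + 1))) := by
    intro i hi
    have := vecMul_wv N M i hi
    rw [hM, petrie_row] at this
    exact this
  set G : ℕ → Fin (N - 1) → ℝ := fun x => if x < a then wv N x else if x = a then wv N (a + 1)
    else wv N (ρ (a + 1)) + R x - R (a + 1) with hG
  have Glt : ∀ x, x < a → G x = wv N x := fun x hx => by simp only [hG, if_pos hx]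
  have Ga : G a = wv N (a + 1) := by simp [hG]
  have Ggt : ∀ x, a < x → G x = wv N (ρ (a + 1)) + R x - R (a + 1) := fun x hx => by
    simp only [hG]; rw [if_neg (by omega), if_neg (by omega)]
  set P : Matrix (Fin (N - 1)) (Fin (N - 1)) ℝ :=
    Matrix.of fun i : Fin (N - 1) => G (i.1 + 2) - G (i.1 + 1) with hP
  have hPw : ∀ x, 1 ≤ x → x ≤ N → (wv N x) ᵥ* P = G x := by
    intro x hx hxN
    obtain ⟨y, rfl⟩ : ∃ y, x = y + 1 := ⟨x - 1, by omega⟩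
    rw [hP, vecMul_wv_of N G y hxN, Glt 1 (by omega), wv_one, sub_zero]
  have hρa : 1 ≤ ρ a := by omega
  have Ra : R (a + 1) - R a = wv N (ρ (a + 1)) - wv N (ρ a) := by
    obtain ⟨b, rfl⟩ : ∃ b, a = b + 1 := ⟨a - 1, by omega⟩
    rw [hRdiff b (by omega)]
    have := hgt (b + 2) (by omega) (by omega) (by omega)
    rw [epsv, if_pos (by omega), one_smul]
  have FA : ∀ x, 1 ≤ x → x < a → G (σ x) = wv N (ρ x) := by
    intro x hx hxa
    by_cases hxs : x = s
    · rw [hxs, h1, h2, Ga]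
    · have := hlt x hx hxa hxs
      rw [Glt _ this.2.2, this.1]
  have FB : ∀ x, a < x → x ≤ N → G (σ x) = wv N (ρ (a + 1)) + R (ρ x) - R (a + 1) := by
    intro x hx hxN
    by_cases hxt : x = t
    · rw [hxt, h4, h5, Glt _ h6]
      have : R a = R (a + 1) - (wv N (ρ (a + 1)) - wv N (ρ a)) := by rw [← Ra]; abel
      rw [this]; abel
    · have := hgt x hx hxN hxt
      rw [Ggt _ (by omega), this.1]
  have Ga1 : G (a + 1) = wv N (ρ (a + 1)) := by rw [Ggt _ (by omega)]; abel
  have hrange : ∀ x, 1 ≤ x → x ≤ N → 1 ≤ σ x ∧ σ x ≤ N := by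
    intro x hx hxN
    rcases lt_trichotomy x a with h | h | h
    · by_cases hxs : x = s
      · subst hxs; omega
      · have := hlt x hx h hxs; omega
    · subst h; omega
    · by_cases hxt : x = t
      · subst hxt; omega
      · have := hgt x h hxN hxt; omega
  apply matSimilar_of (P := P)
  · rw [← Matrix.vecMul_surjective_iff_isUnit]
    set W : Submodule ℝ (Fin (N - 1) → ℝ) := LinearMap.range (Matrix.vecMulLinear P) with hW
    have hmem : ∀ x, 1 ≤ x → x ≤ N → G x ∈ W := fun x hx hxN =>
      ⟨wv N x, by simpa using hPw x hx hxN⟩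
    have hge : ∀ d, a + 1 + d ≤ N → wv N (ρ (a + 1 + d)) ∈ W := by
      intro d
      induction d with
      | zero => intro h; rw [add_zero, ← Ga1]; exact hmem _ (by omega) (by omega)
      | succ d ih =>
        intro h
        have ih' := ih (by omega)
        have e1 : G (a + 1 + d + 1) - G (a + 1 + d) =
            epsv ρ (a + d) • (wv N (ρ (a + 1 + d + 1)) - wv N (ρ (a + 1 + d))) := by
          have := hRdiff (a + d) (by omega)
          rw [show a + 1 + d + 1 = a + d + 2 by ring, show a + 1 + d = a + d + 1 by ring, ← this,
            Ggt _ (by omega), Ggt _ (by omega)]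
          abel
        have e2 : G (a + 1 + d + 1) - G (a + 1 + d) ∈ W :=
          W.sub_mem (hmem _ (by omega) (by omega)) (hmem _ (by omega) (by omega))
        rw [e1] at e2
        have e3 := W.smul_mem (epsv ρ (a + d)) e2
        rw [smul_smul] at e3
        have e4 : epsv ρ (a + d) * epsv ρ (a + d) = 1 := by
          unfold epsv; split_ifs <;> norm_num
        rw [e4, one_smul] at e3
        have e5 := W.add_mem e3 ih'
        rwa [sub_add_cancel] at e5
    have hge' : ∀ x, a < x → x ≤ N → wv N (ρ x) ∈ W := by
      intro x hx hxN
      have := hge (x - (a + 1)) (by omega)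
      rwa [show a + 1 + (x - (a + 1)) = x by omega] at this
    have hall : ∀ z, 1 ≤ z → z ≤ N → wv N z ∈ W := by
      intro z hz hzN
      by_cases hza : z < a
      · rw [← Glt z hza]; exact hmem z hz hzN
      · by_cases hz2 : z = a
        · rw [hz2, ← h5]; exact hge' t (by omega) htN
        · by_cases hz3 : z = a + 1
          · rw [hz3, ← Ga]; exact hmem a (by omega) (by omega)
          · obtain ⟨x, hx1, hx2, rfl⟩ := hsurj z (by omega) hzN
            exact hge' x hx1 hx2
    have htop : W = ⊤ := by
      rw [eq_top_iff]
      intro v _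
      rw [pi_eq_sum_univ' v]
      refine W.sum_mem fun i _ => W.smul_mem _ ?_
      have := wv_succ N i.1 i.2
      have h' := W.sub_mem (hall (i.1 + 2) (by omega) (by omega)) (hall (i.1 + 1) (by omega) (by omega))
      rw [this, add_sub_cancel_left] at h'
      convert h' using 1
    have := LinearMap.range_eq_top.1 htop
    intro v
    obtain ⟨u, hu⟩ := this v
    exact ⟨u, by simpa using hu⟩
  · funext i
    rw [Matrix.mul_apply_eq_vecMul, Matrix.mul_apply_eq_vecMul, petrie_row, Matrix.smul_vecMul,
      Matrix.sub_vecMul]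
    have r1 := hrange (i.1 + 1) (by omega) (by omega)
    have r2 := hrange (i.1 + 2) (by omega) (by omega)
    rw [hPw _ r1.1 r1.2, hPw _ r2.1 r2.2, heps i.1 i.2]
    have hPi : P i = G (i.1 + 2) - G (i.1 + 1) := rfl
    rw [hPi]
    have hi := i.2
    have hd := hRdiff i.1 i.2
    generalize i.1 = n at *
    rcases lt_trichotomy (n + 1) a with h | h | h
    · by_cases h' : n + 2 = a
      · rw [h', h3, Ga1, FA _ (by omega) h, Ga, Glt _ h, Matrix.sub_vecMul]
        have : epsv ρ n = 1 := by
          rw [← heps n hi, epsv, if_pos]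
          have : n + 1 = a - 1 := by omega
          rw [this, h', h3]; omega
        rw [this, one_smul]
        rw [this, one_smul, h'] at hd
        change _ = R (a + 1) - R (n + 1)
        rw [← sub_add_sub_cancel (R (a + 1)) (R a) (R (n + 1)), Ra, hd]
        abel
      · rw [FA _ (by omega) h, FA _ (by omega) (by omega), Glt _ h, Glt _ (by omega),
          Matrix.sub_vecMul]
        exact hd.symm
    · subst h
      rw [FB (n + 2) (by omega) (by omega), h3, Ga1, Ga, Matrix.sub_vecMul]
      have := hgt (n + 2) (by omega) (by omega) (by omega)
      rw [epsv, if_pos (by omega), one_smul]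
      change _ = R (ρ (n + 1 + 1)) - R (n + 1 + 1)
      abel
    · rw [FB _ h (by omega), FB _ (by omega) (by omega), Ggt _ h, Ggt _ (by omega)]
      rw [show wv N (ρ (a + 1)) + R (n + 2) - R (a + 1) - (wv N (ρ (a + 1)) + R (n + 1) - R (a + 1))
        = R (n + 2) - R (n + 1) by abel, hd, Matrix.smul_vecMul, Matrix.sub_vecMul]
      congr 1
      change _ = R (ρ (n + 2)) - R (ρ (n + 1))
      abel

/-- The permutations interpolating between `σ'` and `ρ'`. -/
def tauv (f : ℕ → ℕ) (J K S T C i x : ℕ) : ℕ :=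
  if x = S then i + 1 else if x = T then (if i < J then C else i) else
    if J ≤ x ∧ x < K then (if x ≤ i then (if x = J then C else x - 1) else x + 1) else f x

lemma tauv_S (f : ℕ → ℕ) (J K S T C i : ℕ) : tauv f J K S T C i S = i + 1 := by
  simp [tauv]

lemma tauv_T (f : ℕ → ℕ) (J K S T C i : ℕ) (h : T ≠ S) :
    tauv f J K S T C i T = if i < J then C else i := by
  unfold tauv; rw [if_neg h, if_pos rfl]

lemma tauv_J (f : ℕ → ℕ) (J K S T C i : ℕ) (h1 : J ≠ S) (h2 : J ≠ T) (h3 : J < K) (h4 : J ≤ i) :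
    tauv f J K S T C i J = C := by
  unfold tauv; rw [if_neg h1, if_neg h2, if_pos ⟨le_rfl, h3⟩, if_pos h4, if_pos rfl]

lemma tauv_lo (f : ℕ → ℕ) (J K S T C i x : ℕ) (h1 : x ≠ S) (h2 : x ≠ T) (h3 : J < x) (h4 : x < K)
    (h5 : x ≤ i) : tauv f J K S T C i x = x - 1 := by
  unfold tauv; rw [if_neg h1, if_neg h2, if_pos ⟨h3.le, h4⟩, if_pos h5, if_neg h3.ne']

lemma tauv_hi (f : ℕ → ℕ) (J K S T C i x : ℕ) (h1 : x ≠ S) (h2 : x ≠ T) (h3 : J ≤ x) (h4 : x < K)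
    (h5 : i < x) : tauv f J K S T C i x = x + 1 := by
  unfold tauv; rw [if_neg h1, if_neg h2, if_pos ⟨h3, h4⟩, if_neg (by omega)]

lemma tauv_out (f : ℕ → ℕ) (J K S T C i x : ℕ) (h1 : x ≠ S) (h2 : x ≠ T) (h3 : ¬ (J ≤ x ∧ x < K)) :
    tauv f J K S T C i x = f x := by
  unfold tauv; rw [if_neg h1, if_neg h2, if_neg h3]

lemma gen_similar (N J K S T C : ℕ) (f g : ℕ → ℕ) (hf : IsPermOn N f)
    (hS : 1 ≤ S) (hSJ : S + 2 ≤ J) (hJK : J < K) (hKT : K + 1 ≤ T) (hTN : T ≤ N)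
    (fS : f S = J) (gS : g S = K) (fT : f T = C) (gT : g T = K - 1) (hCJ : C < J)
    (hJC : f (J - 1) < C)
    (hlow : ∀ x, 1 ≤ x → x < J → x ≠ S → f x = g x ∧ f x < J)
    (fmid : ∀ x, J ≤ x → x < K → f x = x + 1) (gJ : g J = C)
    (gmid : ∀ x, J < x → x < K → g x = x - 1)
    (hhigh : ∀ x, K ≤ x → x ≤ N → x ≠ T → f x = g x ∧ K < f x) :
    MatSimilar (petrie N f) (petrie N g) := by
  have e1 : petrie N f = petrie N (tauv f J K S T C (J - 1)) := by
    apply petrie_congr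
    intro x hx hxN
    by_cases c1 : x = S
    · rw [c1, tauv_S, fS]; omega
    by_cases c2 : x = T
    · rw [c2, tauv_T _ _ _ _ _ _ _ (by omega), fT, if_pos (by omega)]
    by_cases c3 : J ≤ x ∧ x < K
    · rw [tauv_hi _ _ _ _ _ _ _ _ c1 c2 c3.1 c3.2 (by omega), fmid x c3.1 c3.2]
    · rw [tauv_out _ _ _ _ _ _ _ _ c1 c2 c3]
  have e2 : petrie N g = petrie N (tauv f J K S T C (K - 1)) := by
    apply petrie_congr
    intro x hx hxN
    by_cases c1 : x = S
    · rw [c1, tauv_S, gS]; omega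
    by_cases c2 : x = T
    · rw [c2, tauv_T _ _ _ _ _ _ _ (by omega), gT, if_neg (by omega)]
    by_cases c3 : J ≤ x ∧ x < K
    · by_cases c4 : x = J
      · rw [c4, tauv_J _ _ _ _ _ _ _ (by omega) (by omega) (by omega) (by omega), gJ]
      · rw [tauv_lo _ _ _ _ _ _ _ _ c1 c2 (by omega) c3.2 (by omega), gmid x (by omega) c3.2]
    · rw [tauv_out _ _ _ _ _ _ _ _ c1 c2 c3]
      by_cases h : x < J
      · exact (hlow x hx h c1).1.symm
      · exact (hhigh x (by omega) hxN c2).1.symm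
  have hmaps : ∀ x, 1 ≤ x → x ≤ N → 1 ≤ f x ∧ f x ≤ N := fun x h1 h2 => hf.mapsTo ⟨h1, h2⟩
  have hpiv : ∀ i, J - 1 ≤ i → i + 1 ≤ K - 1 →
      tauv f J K S T C (i + 1) (i + 1) = if i < J then C else i := by
    intro i hi1 hi2
    by_cases h : i < J
    · rw [if_pos h, show i + 1 = J by omega]
      exact tauv_J _ _ _ _ _ _ _ (by omega) (by omega) (by omega) (by omega)
    · rw [if_neg h]
      rw [tauv_lo _ _ _ _ _ _ _ _ (by omega) (by omega) (by omega) (by omega) (by omega)]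
      omega
  have key : ∀ d, J - 1 + d ≤ K - 1 → MatSimilar (petrie N (tauv f J K S T C (J - 1)))
      (petrie N (tauv f J K S T C (J - 1 + d))) := by
    intro d
    induction d with
    | zero => intro _; exact matSimilar_refl _
    | succ d ih =>
      intro hd
      refine matSimilar_trans (ih (by omega)) ?_
      rw [← add_assoc]
      have hi1 : J - 1 ≤ J - 1 + d := by omega
      have hi2 : J - 1 + d + 1 ≤ K - 1 := by omega
      generalize J - 1 + d = i at hi1 hi2
      have hC1 : 1 ≤ C := by have := hmaps T (by omega) hTN; omega
      apply one_step N (i + 1) S T _ _ hS (by omega) (by omega) hTN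
      · exact tauv_S _ _ _ _ _ _ _
      · exact tauv_S _ _ _ _ _ _ _
      · exact tauv_hi _ _ _ _ _ _ _ _ (by omega) (by omega) (by omega) (by omega) (by omega)
      · rw [tauv_T _ _ _ _ _ _ _ (by omega), hpiv i hi1 hi2]
      · rw [tauv_T _ _ _ _ _ _ _ (by omega), if_neg (by omega)]
      · rw [hpiv i hi1 hi2]; split_ifs <;> omega
      · rw [hpiv i hi1 hi2, Nat.add_sub_cancel]
        by_cases h : i < J
        · rw [if_pos h, tauv_out _ _ _ _ _ _ _ _ (by omega) (by omega) (by omega),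
            show i = J - 1 by omega]
          exact hJC
        · rw [if_neg h]
          by_cases h' : i = J
          · rw [h', tauv_J _ _ _ _ _ _ _ (by omega) (by omega) (by omega) (by omega)]; exact hCJ
          · rw [tauv_lo _ _ _ _ _ _ _ _ (by omega) (by omega) (by omega) (by omega) (by omega)]
            omega
      · intro x hx hxa hxS
        by_cases h : x < J
        · rw [tauv_out _ _ _ _ _ _ _ _ hxS (by omega) (by omega),
            tauv_out _ _ _ _ _ _ _ _ hxS (by omega) (by omega)]
          have m := hmaps x hx (by omega)
          have l := hlow x hx h hxS
          omega
        · by_cases h' : x = J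
          · rw [h', tauv_J _ _ _ _ _ _ _ (by omega) (by omega) (by omega) (by omega),
              tauv_J _ _ _ _ _ _ _ (by omega) (by omega) (by omega) (by omega)]
            omega
          · rw [tauv_lo _ _ _ _ _ _ _ _ (by omega) (by omega) (by omega) (by omega) (by omega),
              tauv_lo _ _ _ _ _ _ _ _ (by omega) (by omega) (by omega) (by omega) (by omega)]
            omega
      · intro x hx hxN hxT
        by_cases h : x < K
        · rw [tauv_hi _ _ _ _ _ _ _ _ (by omega) (by omega) (by omega) (by omega) (by omega),
            tauv_hi _ _ _ _ _ _ _ _ (by omega) (by omega) (by omega) (by omega) (by omega)]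
          omega
        · rw [tauv_out _ _ _ _ _ _ _ _ (by omega) (by omega) (by omega),
            tauv_out _ _ _ _ _ _ _ _ (by omega) (by omega) (by omega)]
          have m := hmaps x (by omega) hxN
          have l := hhigh x (by omega) hxN hxT
          omega
      · intro z hz hzN
        by_cases hzK : z ≤ K
        · refine ⟨z - 1, by omega, by omega, ?_⟩
          rw [tauv_hi _ _ _ _ _ _ _ _ (by omega) (by omega) (by omega) (by omega) (by omega)]
          omega
        · obtain ⟨x, hx, rfl⟩ := hf.surjOn (show z ∈ Set.Icc 1 N from ⟨by omega, hzN⟩)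
          obtain ⟨hx1, hx2⟩ := hx
          have n1 : x ≠ S := by rintro rfl; omega
          have n2 : x ≠ T := by rintro rfl; omega
          have n3 : ¬ x < J := fun h => by have := hlow x hx1 h n1; omega
          have n4 : ¬ x < K := fun h => by have := fmid x (by omega) h; omega
          refine ⟨x, by omega, hx2, ?_⟩
          rw [tauv_out _ _ _ _ _ _ _ _ n1 n2 (by omega)]
  have := key (K - J) (by omega)
  rw [e1, e2]
  rwa [show J - 1 + (K - J) = K - 1 by omega] at this

lemma gen_trace (K J S C : ℕ) (f g : ℕ → ℕ) (hS : 1 ≤ S) (hSJ : S + 2 ≤ J) (hJK : J < K)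
    (fS : f S = J) (gS : g S = K) (fK : f K = C) (hCJ : C < J) (hJC : f (J - 1) < C)
    (hlow : ∀ x, 1 ≤ x → x < J → x ≠ S → f x = g x ∧ f x < J)
    (fmid : ∀ x, J ≤ x → x < K → f x = x + 1) (gJ : g J = C)
    (gmid : ∀ x, J < x → x ≤ K → g x = x - 1) :
    (petrie K g).trace < (petrie K f).trace := by
  have key : ∀ x y, y = x + 1 → 1 ≤ x → y ≤ K →
      (min (g x) (g y) ≤ x ∧ x ≤ max (g x) (g y) - 1) →
      (min (f x) (f y) ≤ x ∧ x ≤ max (f x) (f y) - 1) := by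
    intro x y hxy hx hy h
    have l1 := hlow x hx
    have l2 := hlow y (by omega)
    have m1 := gmid x
    have m2 := gmid y
    rcases lt_trichotomy x (J - 1) with c | c | c
    · by_cases hxS : x = S
      · have := l2 (by omega) (by omega)
        subst hxS; omega
      · have := l1 (by omega) hxS
        by_cases hyS : y = S
        · subst hyS; omega
        · have := l2 (by omega) hyS
          omega
    · have := l1 (by omega) (by omega)
      have hy' : y = J := by omega
      subst hy'
      have := fmid y (by omega) (by omega)
      rw [← c] at hJC
      omega
    · by_cases hxJ : x = J
      · subst hxJ; have := m2 (by omega) hy; omega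
      · have := m1 (by omega) (by omega)
        have := m2 (by omega) hy
        omega
  unfold Matrix.trace
  apply Finset.sum_lt_sum
  · intro i _
    simp only [Matrix.diag_apply, petrie, Matrix.of_apply]
    have := key (i.1 + 1) (i.1 + 2) rfl (by omega) (by omega)
    split_ifs with c1 c2
    · exact le_rfl
    · exact absurd (this c1) c2
    · norm_num
    · exact le_rfl
  · refine ⟨⟨J - 2, by omega⟩, Finset.mem_univ _, ?_⟩
    simp only [Matrix.diag_apply, petrie, Matrix.of_apply]
    rw [show J - 2 + 1 = J - 1 by omega, show J - 2 + 2 = J by omega]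
    have l := hlow (J - 1) (by omega) (by omega) (by omega)
    have m := fmid J le_rfl hJK
    rw [if_neg (by omega), if_pos (by omega)]
    norm_num

/-- A left extension by one point. -/
def leftv (σ : ℕ → ℕ) (x : ℕ) : ℕ := if x = 1 then 1 + σ 1 else if x = 2 then 1 else 1 + σ (x - 1)

lemma leftv_ext (k : ℕ) (hk : 3 ≤ k) (σ : ℕ → ℕ) (hσ : IsPermOn k σ) :
    IsLeftExt k 1 σ (leftv σ) := by
  have hm : ∀ x, 1 ≤ x → x ≤ k → 1 ≤ σ x ∧ σ x ≤ k := fun x h1 h2 => hσ.mapsTo ⟨h1, h2⟩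
  have hinj : ∀ x y, 1 ≤ x → x ≤ k → 1 ≤ y → y ≤ k → σ x = σ y → x = y :=
    fun x y h1 h2 h3 h4 h => hσ.injOn ⟨h1, h2⟩ ⟨h3, h4⟩ h
  refine ⟨⟨?_, ?_, ?_⟩, ?_, 1, le_rfl, le_rfl, ?_, ?_⟩
  · rintro x ⟨h1, h2⟩
    have m1 := hm 1 le_rfl (by omega)
    have m2 := hm (x - 1)
    simp only [leftv, Set.mem_Icc]
    split_ifs <;> omega
  · rintro x ⟨h1, h2⟩ y ⟨h3, h4⟩ h
    have i1 := hinj 1 (y - 1) le_rfl (by omega)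
    have i2 := hinj (x - 1) 1
    have i3 := hinj (x - 1) (y - 1)
    have m1 := hm 1 le_rfl (by omega)
    have m2 := hm (x - 1)
    have m3 := hm (y - 1)
    simp only [leftv] at h
    split_ifs at h <;> omega
  · rintro z ⟨h1, h2⟩
    by_cases hz : z = 1
    · exact ⟨2, ⟨by omega, by omega⟩, by simp [leftv, hz]⟩
    · obtain ⟨x, ⟨hx1, hx2⟩, hx⟩ := hσ.surjOn (show z - 1 ∈ Set.Icc 1 k from ⟨by omega, by omega⟩)
      by_cases hx' : x = 1
      · refine ⟨1, ⟨by omega, by omega⟩, ?_⟩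
        subst hx'
        simp only [leftv, if_true]; omega
      · refine ⟨x + 1, ⟨by omega, by omega⟩, ?_⟩
        simp only [leftv]
        rw [if_neg (by omega), if_neg (by omega), Nat.add_sub_cancel]; omega
  · intro i h1 h2
    simp only [leftv]
    rw [if_neg (by omega), if_neg (by omega), Nat.add_sub_cancel_left]
  · simp [leftv]
  · intro x h1 h2 h3
    have : x = 2 := by omega
    subst this
    simp [leftv]

/-- Theorem 10. -/
theorem thm10_right_two_sided_similar (k j : ℕ) (hj : 3 ≤ j) (hjk : j < k)
    (σ ρ : ℕ → ℕ) (hσ : IsPermOn k σ) (hρ : IsPermOn k ρ)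
    (s : ℕ) (hs1 : 1 ≤ s) (hs2 : s ≤ j - 2) (ha1 : σ s = j) (ha2 : ρ s = k)
    (hb : ∀ x, 1 ≤ x → x ≤ j - 1 → x ≠ s → σ x = ρ x ∧ σ x ≤ j - 1)
    (hc : ∀ x, j ≤ x → x ≤ k - 1 → σ x = x + 1)
    (hd : ∀ x, j + 1 ≤ x → x ≤ k → ρ x = x - 1)
    (he1 : σ (j - 1) = ρ (j - 1)) (he2 : σ (j - 1) < σ k)
    (he3 : σ k = ρ j) (he4 : ρ j ≤ j - 1) :
    RightSimilar k σ ρ ∧ TwoSidedSimilar k σ ρ ∧ ¬ LeftSimilar k σ ρ ∧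
    (petrie k σ).trace ≠ (petrie k ρ).trace ∧
    ¬ MatSimilar (petrie k σ) (petrie k ρ) := by
  have hk : 3 ≤ k := by omega
  have mσ : ∀ x, 1 ≤ x → x ≤ k → 1 ≤ σ x ∧ σ x ≤ k := fun x h1 h2 => hσ.mapsTo ⟨h1, h2⟩
  have htr : (petrie k ρ).trace < (petrie k σ).trace :=
    gen_trace k j s (σ k) σ ρ hs1 (by omega) hjk ha1 ha2 rfl (by omega) he2
      (fun x h1 h2 h3 => by have := hb x h1 (by omega) h3; omega)
      (fun x h1 h2 => hc x h1 (by omega)) he3.symm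
      (fun x h1 h2 => hd x (by omega) h2)
  refine ⟨?_, ?_, ?_, htr.ne', fun h => htr.ne' (matSimilar_trace h)⟩
  · rintro n hn σ' ρ' ⟨⟨pσ, eσ, t1, ht11, ht12, ht13, ht14⟩, ⟨pρ, eρ, -⟩,
      t, ht1, ht2, ht3, ht4, ht5⟩
    have htt : t = t1 := pσ.injOn ⟨by omega, by omega⟩ ⟨by omega, by omega⟩ (ht3.trans ht13.symm)
    subst htt
    refine gen_similar (k + n) j k s t (σ k) σ' ρ' pσ hs1 (by omega) hjk ht1 ht2
      ?_ ?_ ht3 ?_ (by omega) ?_ ?_ ?_ ?_ ?_ ?_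
    · rw [eσ s hs1 (by omega), ha1]
    · rw [eρ s hs1 (by omega), ha2]
    · rw [ht4, hd k (by omega) le_rfl]
    · rw [eσ (j - 1) (by omega) (by omega)]; exact he2
    · intro x h1 h2 h3
      rw [eσ x h1 (by omega), eρ x h1 (by omega)]
      have := hb x h1 (by omega) h3
      omega
    · intro x h1 h2
      rw [eσ x (by omega) (by omega), hc x h1 (by omega)]
    · rw [eρ j (by omega) (by omega), he3]
    · intro x h1 h2
      rw [eρ x (by omega) (by omega), hd x (by omega) (by omega)]
    · intro x h1 h2 h3
      exact ⟨ht5 x h3 h1 h2, ht14 x h3 h1 h2⟩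
  · rintro m n hm hn σ' ρ' ⟨⟨pσ, eσ, ⟨s1, hs11, hs12, hs13, hs14⟩, t1, ht11, ht12, ht13, ht14⟩,
      ⟨pρ, eρ, -, -⟩, u, t, hu1, hu2, ht1, ht2, hu3, hu4, ht3, ht4, hst⟩
    have htt : t = t1 := pσ.injOn ⟨by omega, by omega⟩ ⟨by omega, by omega⟩ (ht3.trans ht13.symm)
    have huu : u = s1 := pσ.injOn ⟨by omega, by omega⟩ ⟨by omega, by omega⟩ (hu3.trans hs13.symm)
    subst htt huu
    have eσ' : ∀ x, m + 2 ≤ x → x ≤ m + k - 1 → σ' x = m + σ (x - m) := by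
      intro x h1 h2
      have := eσ (x - m) (by omega) (by omega)
      rwa [show m + (x - m) = x by omega] at this
    have eρ' : ∀ x, m + 2 ≤ x → x ≤ m + k - 1 → ρ' x = m + ρ (x - m) := by
      intro x h1 h2
      have := eρ (x - m) (by omega) (by omega)
      rwa [show m + (x - m) = x by omega] at this
    refine gen_similar (m + k + n) (m + j) (m + k) (if s = 1 then u else m + s) t (m + σ k) σ' ρ' pσ
      (by split_ifs <;> omega) (by split_ifs <;> omega) (by omega) ht1 ht2
      ?_ ?_ ht3 ?_ (by omega) ?_ ?_ ?_ ?_ ?_ ?_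
    · split_ifs with h
      · subst h; omega
      · rw [eσ s (by omega) (by omega), ha1]
    · split_ifs with h
      · subst h; omega
      · rw [eρ s (by omega) (by omega), ha2]
    · rw [ht4, hd k (by omega) le_rfl]; omega
    · rw [eσ' (m + j - 1) (by omega) (by omega), show m + j - 1 - m = j - 1 by omega]; omega
    · intro x h1 h2 h3
      by_cases hx : m + 2 ≤ x
      · have hxs : x - m ≠ s := by
          split_ifs at h3 <;> omega
        rw [eσ' x hx (by omega), eρ' x hx (by omega)]
        have := hb (x - m) (by omega) (by omega) hxs
        omega
      · by_cases hxu : x = u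
        · have hs : s ≠ 1 := by intro h; rw [if_pos h] at h3; exact h3 hxu
          have := hb 1 le_rfl (by omega) (Ne.symm hs)
          subst hxu
          omega
        · have a1 := hst x hxu (by omega) (Or.inl ⟨h1, by omega⟩)
          have a2 := hs14 x hxu h1 (by omega)
          omega
    · intro x h1 h2
      rw [eσ' x (by omega) (by omega), hc (x - m) (by omega) (by omega)]; omega
    · rw [eρ j (by omega) (by omega), he3]
    · intro x h1 h2
      rw [eρ' x (by omega) (by omega), hd (x - m) (by omega) (by omega)]; omega
    · intro x h1 h2 h3
      exact ⟨hst x (by omega) h3 (Or.inr ⟨h1, h2⟩), ht14 x h3 h1 h2⟩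
  · intro hL
    have hsim := hL 1 le_rfl (leftv σ) (leftv ρ) ⟨leftv_ext k hk σ hσ, leftv_ext k hk ρ hρ,
      1, le_rfl, le_rfl, by simp [leftv], by simp [leftv], by
        intro x h1 h2 h3
        have : x = 2 := by omega
        subst this
        simp [leftv]⟩
    have hv : ∀ f x, 3 ≤ x → leftv f x = 1 + f (x - 1) := by
      intro f x hx
      simp only [leftv]
      rw [if_neg (by omega), if_neg (by omega)]
    have v1 : ∀ f, leftv f 1 = 1 + f 1 := fun f => by simp [leftv]
    have v2 : ∀ f, leftv f 2 = 1 := fun f => by simp [leftv]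
    have := gen_trace (1 + k) (1 + j) (if s = 1 then 1 else 1 + s) (1 + σ k) (leftv σ) (leftv ρ)
      (by split_ifs <;> omega) (by split_ifs <;> omega) (by omega)
      (by
        split_ifs with h
        · subst h; rw [v1, ha1]
        · rw [hv _ _ (by omega), Nat.add_sub_cancel_left, ha1])
      (by
        split_ifs with h
        · subst h; rw [v1, ha2]
        · rw [hv _ _ (by omega), Nat.add_sub_cancel_left, ha2])
      (by rw [hv _ _ (by omega), Nat.add_sub_cancel_left]) (by omega)
      (by
        rw [hv _ _ (by omega), show 1 + j - 1 - 1 = j - 1 by omega]; omega)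
      (by
        intro x h1 h2 h3
        by_cases hx : 3 ≤ x
        · have hxs : x - 1 ≠ s := by split_ifs at h3 <;> omega
          rw [hv _ _ hx, hv _ _ hx]
          have := hb (x - 1) (by omega) (by omega) hxs
          omega
        · by_cases hx2 : x = 2
          · subst hx2; rw [v2, v2]; omega
          · have hx1 : x = 1 := by omega
            subst hx1
            have hs : s ≠ 1 := by intro h; rw [if_pos h] at h3; exact h3 rfl
            have := hb 1 le_rfl (by omega) (Ne.symm hs)
            rw [v1, v1]; omega)
      (by
        intro x h1 h2
        rw [hv _ _ (by omega), hc (x - 1) (by omega) (by omega)]; omega)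
      (by rw [hv _ _ (by omega), Nat.add_sub_cancel_left, he3])
      (by
        intro x h1 h2
        rw [hv _ _ (by omega), hd (x - 1) (by omega) (by omega)]; omega)
    exact this.ne' (matSimilar_trace hsim)
end
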